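/- Let m ≥ 2 and η ∈ W^{2-m,2}(B^{2m}, so(n)). Then there exists Ω ∈ W^{m-1,2}(B^{2m}, so(n) ⊗ Λ¹ℝ^{2m}) such that Δ^{m-2}δΩ = −η in B^{2m}, together with the estimate ‖Ω‖_{W^{m-1,2}(B^{2m})} ≤ c‖η‖_{W^{2-m,2}(B^{2m})}. -/

import Mathlib

open MeasureTheory Set
open scoped ENNReal NNReal
noncomputable section

attribute [local instance] Matrix.frobeniusNormedAddCommGroup Matrix.frobeniusNormedSpace

namespace CL

abbrev Euc (N : ℕ) := EuclideanSpace ℝ (Fin N)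
abbrev Vec (n : ℕ) := Fin n → ℝ
abbrev Mat (n : ℕ) := Matrix (Fin n) (Fin n) ℝ

/-- the open unit ball `B^N ⊆ ℝ^N` -/
def ballUnit (N : ℕ) : Set (Euc N) := Metric.ball 0 1

/-- the concentric open ball of radius `r` -/
def ballR (N : ℕ) (r : ℝ) : Set (Euc N) := Metric.ball 0 r

variable {N : ℕ} {E : Type*} [NormedAddCommGroup E] [NormedSpace ℝ E]

/-- classical partial derivative in the `i`-th coordinate direction -/
def pd (i : Fin N) (f : Euc N → E) : Euc N → E :=
  fun x => fderiv ℝ f x (EuclideanSpace.single i 1)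

/-- iterated classical partial derivative along a multi-index -/
def mderiv (α : Fin N → ℕ) (f : Euc N → E) : Euc N → E :=
  (List.finRange N).foldr (fun i g => (pd i)^[α i] g) f

/-- degree of a multi-index -/
def mdeg {N : ℕ} (α : Fin N → ℕ) : ℕ := ∑ i, α i

/-- the multi-index `e_i` -/
def single1 (i : Fin N) : Fin N → ℕ := fun j => if j = i then 1 else 0

/-- Laplacian -/
def lap (f : Euc N → E) : Euc N → E := fun x => ∑ i, pd i (pd i f) x

/-- iterated Laplacian `Δ^k` -/
def polylap : ℕ → (Euc N → E) → Euc N → E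
  | 0, f => f
  | k + 1, f => lap (polylap k f)

/-- gradient / exterior derivative of a function, as a `1`-form -/
def gradf (f : Euc N → E) : Euc N → Fin N → E := fun x i => pd i f x

/-- codifferential (divergence) of a `1`-form -/
def codiff1 (ω : Euc N → Fin N → E) : Euc N → E := fun x => ∑ i, pd i (fun y => ω y i) x

/-- test functions on an open set -/
structure IsTestFun (Ω : Set (Euc N)) (φ : Euc N → ℝ) : Prop where
  smooth : ContDiff ℝ (⊤ : ℕ∞) φ
  supp_subset : tsupport φ ⊆ Ω
  supp_compact : IsCompact (tsupport φ)

/-- `g` is the `α`-th weak derivative of `f` on `Ω` -/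
def HasWeakDeriv (Ω : Set (Euc N)) (α : Fin N → ℕ) (f g : Euc N → E) : Prop :=
  ∀ φ : Euc N → ℝ, IsTestFun Ω φ →
    ∫ x in Ω, mderiv α φ x • f x = ((-1 : ℝ) ^ mdeg α) • ∫ x in Ω, φ x • g x

/-- distribution function of `f` -/
def distFn {X : Type*} [MeasurableSpace X] (μ : Measure X) (f : X → E) (t : ℝ≥0∞) : ℝ≥0∞ :=
  μ {x | t < (‖f x‖₊ : ℝ≥0∞)}

/-- decreasing rearrangement of `f` -/
def rearr {X : Type*} [MeasurableSpace X] (μ : Measure X) (f : X → E) (s : ℝ) : ℝ≥0∞ :=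
  sInf {t : ℝ≥0∞ | distFn μ f t ≤ ENNReal.ofReal s}

/-- the Lorentz quasinorm `‖f‖_{L^{p,q}}` -/
def lorentzNorm {X : Type*} [MeasurableSpace X] (p q : ℝ≥0∞) (μ : Measure X) (f : X → E) :
    ℝ≥0∞ :=
  if q = ⊤ then ⨆ s : ℝ, ENNReal.ofReal s ^ (1 / p).toReal * rearr μ f s
  else (∫⁻ s in Ioi (0 : ℝ), (ENNReal.ofReal s ^ (1 / p).toReal * rearr μ f s) ^ q.toReal *
      ENNReal.ofReal s⁻¹) ^ (1 / q.toReal)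

/-- Lorentz quasinorm on a subset of `ℝ^N` (w.r.t. Lebesgue measure) -/
def lorentzNormOn (p q : ℝ≥0∞) (Ω : Set (Euc N)) (f : Euc N → E) : ℝ≥0∞ :=
  lorentzNorm p q (volume.restrict Ω) f

/-- membership in the Lorentz space `L^{p,q}(Ω)` -/
def MemLorentz (p q : ℝ≥0∞) (Ω : Set (Euc N)) (f : Euc N → E) : Prop :=
  AEStronglyMeasurable f (volume.restrict Ω) ∧ lorentzNormOn p q Ω f < ⊤

/-- the finset of multi-indices of degree at most `k` (coded with bounded entries) -/
def mIdx (N k : ℕ) : Finset (Fin N → Fin (k + 1)) :=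
  Finset.univ.filter fun α => (∑ i, (α i : ℕ)) ≤ k

/-- decode a bounded multi-index -/
def toMI {N k : ℕ} (α : Fin N → Fin (k + 1)) : Fin N → ℕ := fun i => (α i : ℕ)

/-- membership in the Lorentz–Sobolev space `W^{k,p,q}(Ω)`:
all weak derivatives up to order `k` exist and lie in `L^{p,q}(Ω)` -/
def MemSL (k : ℕ) (p q : ℝ≥0∞) (Ω : Set (Euc N)) (f : Euc N → E) : Prop :=
  ∃ g : (Fin N → ℕ) → Euc N → E,
    (∀ α, mdeg α ≤ k → HasWeakDeriv Ω α f (g α)) ∧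
    ∀ α, mdeg α ≤ k → MemLorentz p q Ω (g α)

/-- the Lorentz–Sobolev norm `‖f‖_{W^{k,p,q}(Ω)}` -/
def slNorm (k : ℕ) (p q : ℝ≥0∞) (Ω : Set (Euc N)) (f : Euc N → E) : ℝ≥0∞ :=
  sInf {M | ∃ g : (Fin N → ℕ) → Euc N → E,
    (∀ α, mdeg α ≤ k → HasWeakDeriv Ω α f (g α)) ∧
    M = ∑ α ∈ mIdx N k, lorentzNormOn p q Ω (g (toMI α))}

/-- the top-order homogeneous Lorentz–Sobolev seminorm `‖D^k f‖_{L^{p,q}(Ω)}` -/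
def slTopNorm (k : ℕ) (p q : ℝ≥0∞) (Ω : Set (Euc N)) (f : Euc N → E) : ℝ≥0∞ :=
  sInf {M | ∃ g : (Fin N → ℕ) → Euc N → E,
    (∀ α, mdeg α = k → HasWeakDeriv Ω α f (g α)) ∧
    M = ∑ α ∈ (mIdx N k).filter (fun α => (∑ i, (α i : ℕ)) = k),
        lorentzNormOn p q Ω (g (toMI α))}

/-- membership (of a measurable function, viewed as a distribution) in the negative
Lorentz–Sobolev space `W^{-k,p,q}(Ω)`, via representations `f = Σ_{|α| ≤ k} ∂^α g_α` -/
def MemSLneg (k : ℕ) (p q : ℝ≥0∞) (Ω : Set (Euc N)) (f : Euc N → E) : Prop :=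
  ∃ g : (Fin N → ℕ) → Euc N → E,
    (∀ α, mdeg α ≤ k → MemLorentz p q Ω (g α)) ∧
    ∀ φ : Euc N → ℝ, IsTestFun Ω φ →
      ∫ x in Ω, φ x • f x =
        ∑ α ∈ mIdx N k,
          ((-1 : ℝ) ^ mdeg (toMI α)) • ∫ x in Ω, mderiv (toMI α) φ x • g (toMI α) x

/-- the norm of the negative Lorentz–Sobolev space `W^{-k,p,q}(Ω)` -/
def slNegNorm (k : ℕ) (p q : ℝ≥0∞) (Ω : Set (Euc N)) (f : Euc N → E) : ℝ≥0∞ :=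
  sInf {M | ∃ g : (Fin N → ℕ) → Euc N → E,
    (∀ φ : Euc N → ℝ, IsTestFun Ω φ →
      ∫ x in Ω, φ x • f x =
        ∑ α ∈ mIdx N k,
          ((-1 : ℝ) ^ mdeg (toMI α)) • ∫ x in Ω, mderiv (toMI α) φ x • g (toMI α) x) ∧
    M = ∑ α ∈ mIdx N k, lorentzNormOn p q Ω (g (toMI α))}

/-- membership in `W^{s,p,q}(Ω)` for an integer order `s` -/
def MemSLz (s : ℤ) (p q : ℝ≥0∞) (Ω : Set (Euc N)) (f : Euc N → E) : Prop :=
  if 0 ≤ s then MemSL s.toNat p q Ω f else MemSLneg (-s).toNat p q Ω f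

/-- the `W^{s,p,q}(Ω)`-norm for an integer order `s` -/
def slzNorm (s : ℤ) (p q : ℝ≥0∞) (Ω : Set (Euc N)) (f : Euc N → E) : ℝ≥0∞ :=
  if 0 ≤ s then slNorm s.toNat p q Ω f else slNegNorm (-s).toNat p q Ω f

/-- `A ∈ SO(n)` -/
def IsSO {n : ℕ} (A : Mat n) : Prop := A.transpose * A = 1 ∧ A.det = 1

/-- `A ∈ so(n)`, i.e. `A` is antisymmetric -/
def IsAntisym {n : ℕ} (A : Mat n) : Prop := A.transpose = -A


/-- `∇^⊥`-style rotation of a pair: `perp v = (-(v 1), v 0)` -/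
def perp {E : Type*} [Neg E] (v : Fin 2 → E) : Fin 2 → E := ![-(v 1), v 0]

end CL

namespace CL

section Lorentz

variable {X : Type*} [MeasurableSpace X] {μ : Measure X} {E : Type*} [NormedAddCommGroup E]

lemma distFn_antitone (μ : Measure X) (f : X → E) : Antitone (distFn μ f) :=
  fun _ _ h => measure_mono fun _ hx => lt_of_le_of_lt h hx

/-- The decreasing rearrangement is the generalised inverse of the distribution function. -/
lemma rearr_le_iff (f : X → E) (s : ℝ) (t : ℝ≥0∞) :
    rearr μ f s ≤ t ↔ distFn μ f t ≤ ENNReal.ofReal s := by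
  refine ⟨fun h => ?_, fun h => sInf_le h⟩
  rcases eq_or_ne t ⊤ with rfl | ht
  · simp [distFn]
  obtain ⟨u, hu, hut, hlim⟩ := exists_seq_strictAnti_tendsto' (lt_top_iff_ne_top.2 ht)
  have hU : {x | t < (‖f x‖₊ : ℝ≥0∞)} = ⋃ n, {x | u n < (‖f x‖₊ : ℝ≥0∞)} := by
    ext x
    simp only [mem_ofPred_eq, mem_iUnion]
    refine ⟨fun hx => ?_, fun ⟨n, hn⟩ => (hut n).1.trans hn⟩
    exact ((hlim.eventually (gt_mem_nhds hx))).exists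
  have hm : Monotone fun n => {x | u n < (‖f x‖₊ : ℝ≥0∞)} :=
    fun a b hab x hx => lt_of_le_of_lt (hu.antitone hab) hx
  change μ _ ≤ _
  rw [hU, hm.measure_iUnion]
  refine iSup_le fun n => ?_
  obtain ⟨v, hv, hvu⟩ := sInf_lt_iff.1 (h.trans_lt (hut n).1)
  exact (distFn_antitone μ f hvu.le).trans hv

lemma rearr_antitone (μ : Measure X) (f : X → E) : Antitone (rearr μ f) := fun a b hab => by
  rw [rearr_le_iff]
  exact ((rearr_le_iff f a _).1 le_rfl).trans (ENNReal.ofReal_le_ofReal hab)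

lemma rearr_mono {F : Type*} [NormedAddCommGroup F] {f : X → E} {g : X → F}
    (h : ∀ x, ‖f x‖ ≤ ‖g x‖) (s : ℝ) : rearr μ f s ≤ rearr μ g s := by
  rw [rearr_le_iff]
  refine le_trans (measure_mono fun x hx => ?_) ((rearr_le_iff g s _).1 le_rfl)
  rw [mem_ofPred_eq] at hx ⊢
  exact hx.trans_le (by exact_mod_cast h x)

lemma lorentzNorm_two_two (f : X → E) :
    lorentzNorm 2 2 μ f = (∫⁻ s in Ioi (0 : ℝ), rearr μ f s ^ (2 : ℝ)) ^ (1 / (2 : ℝ)) := by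
  rw [lorentzNorm, if_neg (by simp)]
  simp only [ENNReal.toReal_ofNat]
  congr 1
  refine setLIntegral_congr_fun measurableSet_Ioi fun s hs => ?_
  have hs : 0 < s := hs
  rw [ENNReal.mul_rpow_of_nonneg _ _ (by norm_num : (0 : ℝ) ≤ 2), ← ENNReal.rpow_mul]
  have h1 : (1 / (2 : ℝ≥0∞)).toReal * 2 = 1 := by simp
  rw [h1, ENNReal.rpow_one, mul_right_comm, ← ENNReal.ofReal_mul hs.le, mul_inv_cancel₀ hs.ne']
  simp

lemma lorentzNorm_mono {F : Type*} [NormedAddCommGroup F] {f : X → E} {g : X → F}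
    (h : ∀ x, ‖f x‖ ≤ ‖g x‖) : lorentzNorm 2 2 μ f ≤ lorentzNorm 2 2 μ g := by
  rw [lorentzNorm_two_two, lorentzNorm_two_two]
  gcongr with s
  exact rearr_mono h s

lemma rearr_lt_top [IsFiniteMeasure μ] {f : X → E} (hf : AEStronglyMeasurable f μ) {s : ℝ}
    (hs : 0 < s) : rearr μ f s < ⊤ := by
  have hlim : Filter.Tendsto (μ ∘ fun n : ℕ => {x | (n : ℝ≥0∞) < (‖f x‖₊ : ℝ≥0∞)}) Filter.atTop
      (nhds (μ (⋂ n : ℕ, {x | (n : ℝ≥0∞) < (‖f x‖₊ : ℝ≥0∞)}))) := by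
    refine tendsto_measure_iInter_atTop (fun n => ?_) (fun a b hab x hx => ?_)
      ⟨0, measure_ne_top _ _⟩
    · exact nullMeasurableSet_lt aemeasurable_const hf.enorm
    · rw [mem_ofPred_eq] at hx ⊢
      exact lt_of_le_of_lt (by exact_mod_cast hab) hx
  have hempty : (⋂ n : ℕ, {x | (n : ℝ≥0∞) < (‖f x‖₊ : ℝ≥0∞)}) = ∅ := by
    ext x
    simp only [mem_iInter, mem_ofPred_eq, mem_empty_iff_false, iff_false, not_forall, not_lt]
    obtain ⟨n, hn⟩ := exists_nat_ge ‖f x‖₊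
    exact ⟨n, by exact_mod_cast hn⟩
  rw [hempty, measure_empty] at hlim
  obtain ⟨n, hn⟩ := (hlim.eventually (gt_mem_nhds (ENNReal.ofReal_pos.2 hs))).exists
  exact ((rearr_le_iff f s n).2 hn.le).trans_lt (by simp)

/-- On a finite measure space the Lorentz norm of `L^{2,2}` is the norm of `L²`. -/
lemma lorentzNorm_eq_eLpNorm [IsFiniteMeasure μ] {f : X → E} (hf : AEStronglyMeasurable f μ) :
    lorentzNorm 2 2 μ f = eLpNorm f 2 μ := by
  rw [lorentzNorm_two_two, eLpNorm_eq_lintegral_rpow_enorm_toReal (by simp) (by simp)]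
  simp only [ENNReal.toReal_ofNat]
  congr 1
  have h1 : ∫⁻ s in Ioi (0 : ℝ), rearr μ f s ^ (2 : ℝ) =
      ∫⁻ s in Ioi (0 : ℝ), ENNReal.ofReal ((rearr μ f s).toReal ^ (2 : ℝ)) := by
    refine setLIntegral_congr_fun measurableSet_Ioi fun s hs => ?_
    rw [ENNReal.toReal_rpow, ENNReal.ofReal_toReal]
    exact (ENNReal.rpow_lt_top_of_nonneg (by norm_num) (rearr_lt_top hf hs).ne).ne
  have h2 : ∫⁻ x, ‖f x‖ₑ ^ (2 : ℝ) ∂μ = ∫⁻ x, ENNReal.ofReal (‖f x‖ ^ (2 : ℝ)) ∂μ := by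
    refine lintegral_congr fun x => ?_
    rw [← ENNReal.ofReal_rpow_of_nonneg (norm_nonneg _) (by norm_num), ofReal_norm]
  have hG : AEMeasurable (fun s => (rearr μ f s).toReal) (volume.restrict (Ioi (0 : ℝ))) :=
    (rearr_antitone μ f).measurable.ennreal_toReal.aemeasurable
  rw [h1, h2, lintegral_rpow_eq_lintegral_meas_lt_mul _
      (Filter.Eventually.of_forall fun s => ENNReal.toReal_nonneg) hG (by norm_num),
    lintegral_rpow_eq_lintegral_meas_lt_mul _
      (Filter.Eventually.of_forall fun s => norm_nonneg _) hf.norm.aemeasurable (by norm_num)]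
  congr 1
  refine setLIntegral_congr_fun measurableSet_Ioi fun t ht => ?_
  have ht : 0 < t := ht
  congr 1
  have hfin : distFn μ f (ENNReal.ofReal t) ≠ ⊤ := measure_ne_top _ _
  have h3 : μ {a | t < ‖f a‖} = distFn μ f (ENNReal.ofReal t) := by
    unfold distFn
    congr 1
    ext x
    simp only [mem_ofPred_eq]
    rw [← enorm_eq_nnnorm, ← ofReal_norm]
    exact (ENNReal.ofReal_lt_ofReal_iff_of_nonneg ht.le).symm
  have h4 : {a | t < (rearr μ f a).toReal} ∩ Ioi (0 : ℝ) =
      Ioo 0 (distFn μ f (ENNReal.ofReal t)).toReal := by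
    ext s
    simp only [mem_inter_iff, mem_ofPred_eq, mem_Ioi, mem_Ioo]
    rw [and_comm]
    refine and_congr_right fun hs => ?_
    rw [← ENNReal.ofReal_lt_iff_lt_toReal ht.le (rearr_lt_top hf hs).ne,
      ← ENNReal.ofReal_lt_iff_lt_toReal hs.le hfin, ← not_le, ← not_le,
      rearr_le_iff]
  rw [h3, Measure.restrict_apply' measurableSet_Ioi, h4, Real.volume_Ioo, sub_zero,
    ENNReal.ofReal_toReal hfin]

end Lorentz

end CL

open scoped FourierTransform LineDeriv ComplexConjugate

namespace CL

/-- A functional dominated by a linear map into a Hilbert space is represented by a vector. -/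
lemma exists_representing_vector {V H : Type*} [AddCommGroup V] [Module ℝ V]
    [NormedAddCommGroup H] [InnerProductSpace ℝ H] [CompleteSpace H] (A : V →ₗ[ℝ] H)
    (T : V →ₗ[ℝ] ℝ) {C : ℝ} (hC : 0 ≤ C) (h : ∀ v, |T v| ≤ C * ‖A v‖) :
    ∃ F : H, ‖F‖ ≤ C ∧ ∀ v, T v = inner ℝ F (A v) := by
  have hker : LinearMap.ker A ≤ LinearMap.ker T := fun v hv => by
    have := h v
    rw [LinearMap.mem_ker.1 hv, norm_zero, mul_zero] at this
    exact LinearMap.mem_ker.2 (abs_eq_zero.1 (le_antisymm this (abs_nonneg _)))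
  let l : LinearMap.range A →ₗ[ℝ] ℝ :=
    ((LinearMap.ker A).liftQ T hker).comp A.quotKerEquivRange.symm.toLinearMap
  have hl : ∀ v, l ⟨A v, LinearMap.mem_range_self A v⟩ = T v := fun v => by
    have : A.quotKerEquivRange.symm ⟨A v, LinearMap.mem_range_self A v⟩ =
        (LinearMap.ker A).mkQ v := by
      rw [LinearEquiv.symm_apply_eq]
      rfl
    simp only [l, LinearMap.comp_apply, LinearEquiv.coe_coe]
    rw [this]
    rfl
  have hb : ∀ y, ‖l y‖ ≤ C * ‖y‖ := by
    rintro ⟨y, v, rfl⟩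
    rw [hl]
    exact h v
  obtain ⟨g, hg, hgn⟩ := exists_extension_norm_eq _ (l.mkContinuous C hb)
  refine ⟨(InnerProductSpace.toDual ℝ H).symm g, ?_, fun v => ?_⟩
  · rw [LinearIsometryEquiv.norm_map, hgn]
    exact LinearMap.mkContinuous_norm_le _ hC _
  · rw [InnerProductSpace.toDual_symm_apply]
    have := hg ⟨A v, LinearMap.mem_range_self A v⟩
    rw [this]
    exact (hl v).symm

section TestFunctions

variable {N : ℕ} {U : Set (Euc N)} {φ ψ : Euc N → ℝ}

lemma IsTestFun.add (hφ : IsTestFun U φ) (hψ : IsTestFun U ψ) : IsTestFun U (φ + ψ) where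
  smooth := hφ.smooth.add hψ.smooth
  supp_subset := (tsupport_add φ ψ).trans (union_subset hφ.supp_subset hψ.supp_subset)
  supp_compact := (hφ.supp_compact.union hψ.supp_compact).of_isClosed_subset
    (isClosed_tsupport _) (tsupport_add φ ψ)

lemma IsTestFun.smul (hφ : IsTestFun U φ) (c : ℝ) : IsTestFun U (c • φ) where
  smooth := contDiff_const.smul hφ.smooth
  supp_subset := (tsupport_smul_subset_right (fun _ => c) φ).trans hφ.supp_subset
  supp_compact := hφ.supp_compact.of_isClosed_subset (isClosed_tsupport _)
    (tsupport_smul_subset_right (fun _ => c) φ)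

lemma isTestFun_zero : IsTestFun U (0 : Euc N → ℝ) where
  smooth := contDiff_const
  supp_subset := by simp [tsupport]
  supp_compact := by simp [tsupport]

lemma isTestFun_sum {ι : Type*} (s : Finset ι) {f : ι → Euc N → ℝ}
    (hf : ∀ i ∈ s, IsTestFun U (f i)) : IsTestFun U (∑ i ∈ s, f i) := by
  classical
  induction s using Finset.induction_on with
  | empty => simpa using isTestFun_zero
  | insert a s ha ih =>
    rw [Finset.sum_insert ha]
    exact (hf a (by simp)).add (ih fun i hi => hf i (by simp [hi]))

lemma IsTestFun.pd (hφ : IsTestFun U φ) (i : Fin N) : IsTestFun U (pd i φ) where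
  smooth := (hφ.smooth.fderiv_right (m := (⊤ : ℕ∞)) (by simp)).clm_apply contDiff_const
  supp_subset := (tsupport_fderiv_apply_subset ℝ _).trans hφ.supp_subset
  supp_compact := hφ.supp_compact.of_isClosed_subset (isClosed_tsupport _)
    (tsupport_fderiv_apply_subset ℝ _)

lemma IsTestFun.pd_iterate (hφ : IsTestFun U φ) (i : Fin N) (k : ℕ) :
    IsTestFun U ((CL.pd i)^[k] φ) := by
  induction k with
  | zero => exact hφ
  | succ k ih => rw [Function.iterate_succ_apply']; exact ih.pd i

lemma IsTestFun.foldr_pd (hφ : IsTestFun U φ) (α : Fin N → ℕ) (l : List (Fin N)) :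
    IsTestFun U (l.foldr (fun i g => (CL.pd i)^[α i] g) φ) := by
  induction l with
  | nil => exact hφ
  | cons i l ih => exact ih.pd_iterate i _

lemma IsTestFun.mderiv (hφ : IsTestFun U φ) (α : Fin N → ℕ) : IsTestFun U (mderiv α φ) :=
  hφ.foldr_pd α _

lemma lap_eq_sum (f : Euc N → ℝ) : lap f = ∑ i, pd i (pd i f) := by
  ext x
  simp [lap]

lemma IsTestFun.polylap (hφ : IsTestFun U φ) (k : ℕ) : IsTestFun U (polylap k φ) := by
  induction k with
  | zero => exact hφ
  | succ k ih =>
    rw [CL.polylap, lap_eq_sum]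
    exact isTestFun_sum _ fun i _ => (ih.pd i).pd i

/-- A test function as a complex valued Schwartz function. -/
def IsTestFun.toSchwartz (hφ : IsTestFun U φ) : SchwartzMap (Euc N) ℂ :=
  HasCompactSupport.toSchwartzMap (f := fun x => (φ x : ℂ))
    (HasCompactSupport.comp_left (g := fun t : ℝ => (t : ℂ)) hφ.supp_compact (by simp))
    (Complex.ofRealCLM.contDiff.comp hφ.smooth)

lemma IsTestFun.toSchwartz_apply (hφ : IsTestFun U φ) (x : Euc N) :
    hφ.toSchwartz x = (φ x : ℂ) := rfl

/-- The Fourier transform of a real function. -/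
def fhat (φ : Euc N → ℝ) : Euc N → ℂ := 𝓕 fun x => (φ x : ℂ)

lemma IsTestFun.fourier_toSchwartz (hφ : IsTestFun U φ) :
    ⇑(𝓕 hφ.toSchwartz : SchwartzMap (Euc N) ℂ) = fhat φ := rfl

lemma fhat_add (hφ : IsTestFun U φ) (hψ : IsTestFun U ψ) : fhat (φ + ψ) = fhat φ + fhat ψ := by
  rw [← hφ.fourier_toSchwartz, ← hψ.fourier_toSchwartz, ← (hφ.add hψ).fourier_toSchwartz]
  have : (hφ.add hψ).toSchwartz = hφ.toSchwartz + hψ.toSchwartz := by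
    ext x
    simp [IsTestFun.toSchwartz_apply]
  rw [this, FourierTransform.fourier_add]
  rfl

lemma fhat_smul (hφ : IsTestFun U φ) (c : ℝ) : fhat (c • φ) = (c : ℂ) • fhat φ := by
  rw [← hφ.fourier_toSchwartz, ← (hφ.smul c).fourier_toSchwartz]
  have : (hφ.smul c).toSchwartz = (c : ℂ) • hφ.toSchwartz := by
    ext x
    simp [IsTestFun.toSchwartz_apply]
  rw [this, FourierTransform.fourier_smul]
  rfl

lemma fhat_zero : fhat (0 : Euc N → ℝ) = 0 := by
  have h := fhat_smul (isTestFun_zero (U := univ) (N := N)) 0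
  simpa using h

lemma fhat_sum {ι : Type*} (s : Finset ι) {f : ι → Euc N → ℝ}
    (hf : ∀ i ∈ s, IsTestFun U (f i)) : fhat (∑ i ∈ s, f i) = ∑ i ∈ s, fhat (f i) := by
  classical
  induction s using Finset.induction_on with
  | empty => simpa using fhat_zero
  | insert a s ha ih =>
    have h1 : ∀ i ∈ s, IsTestFun U (f i) := fun i hi => hf i (by simp [hi])
    rw [Finset.sum_insert ha, Finset.sum_insert ha, fhat_add (hf a (by simp)) (isTestFun_sum s h1),
      ih h1]

/-- The Fourier symbol of `∂_i`. -/
def sym (i : Fin N) (ξ : Euc N) : ℂ := 2 * Real.pi * Complex.I * (ξ i : ℂ)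

/-- The Fourier symbol of `∂^α`. -/
def msym (α : Fin N → ℕ) (ξ : Euc N) : ℂ := ∏ i, sym i ξ ^ α i

lemma fhat_pd (hφ : IsTestFun U φ) (i : Fin N) (ξ : Euc N) :
    fhat (pd i φ) ξ = sym i ξ * fhat φ ξ := by
  have h : (hφ.pd i).toSchwartz = ∂_{(EuclideanSpace.single i 1 : Euc N)} hφ.toSchwartz := by
    ext x
    rw [SchwartzMap.lineDerivOp_apply_eq_fderiv]
    have hd : HasFDerivAt φ (fderiv ℝ φ x) x :=
      (hφ.smooth.differentiable (by simp)).differentiableAt.hasFDerivAt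
    have hc := (Complex.ofRealCLM.hasFDerivAt (x := φ x)).comp x hd
    have hc' : HasFDerivAt (⇑hφ.toSchwartz) (Complex.ofRealCLM.comp (fderiv ℝ φ x)) x := hc
    rw [hc'.fderiv]
    rfl
  rw [← (hφ.pd i).fourier_toSchwartz, h, SchwartzMap.fourier_lineDerivOp_eq]
  have ht : (fun x : Euc N => inner ℝ x (EuclideanSpace.single i (1 : ℝ))).HasTemperateGrowth := by
    fun_prop
  rw [smul_apply, SchwartzMap.smulLeftCLM_apply_apply ht, hφ.fourier_toSchwartz]
  simp [sym, EuclideanSpace.inner_single_right]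
  ring

lemma fhat_pd_iterate (hφ : IsTestFun U φ) (i : Fin N) (k : ℕ) (ξ : Euc N) :
    fhat ((pd i)^[k] φ) ξ = sym i ξ ^ k * fhat φ ξ := by
  induction k with
  | zero => simp
  | succ k ih =>
    rw [Function.iterate_succ_apply', fhat_pd (hφ.pd_iterate i k), ih]
    ring

lemma fhat_mderiv (hφ : IsTestFun U φ) (α : Fin N → ℕ) (ξ : Euc N) :
    fhat (mderiv α φ) ξ = msym α ξ * fhat φ ξ := by
  have h : ∀ l : List (Fin N), fhat (l.foldr (fun i g => (pd i)^[α i] g) φ) ξ =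
      (l.map fun i => sym i ξ ^ α i).prod * fhat φ ξ := by
    intro l
    induction l with
    | nil => simp
    | cons i l ih =>
      rw [List.foldr_cons, fhat_pd_iterate (hφ.foldr_pd α l), ih, List.map_cons, List.prod_cons,
        mul_assoc]
  rw [mderiv, h, msym, Fin.prod_univ_def]

lemma sum_sym_sq (ξ : Euc N) : ∑ i, sym i ξ * sym i ξ = -((2 * Real.pi * ‖ξ‖) ^ 2 : ℝ) := by
  have h : ‖ξ‖ ^ 2 = ∑ i, ξ i ^ 2 := by
    rw [EuclideanSpace.norm_sq_eq]; simp
  rw [mul_pow, h, Finset.mul_sum]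
  push_cast
  rw [← Finset.sum_neg_distrib]
  refine Finset.sum_congr rfl fun i _ => ?_
  rw [sym]
  linear_combination ((2 * Real.pi) ^ 2 * (ξ i : ℂ) ^ 2) * Complex.I_sq

lemma fhat_lap (hφ : IsTestFun U φ) (ξ : Euc N) :
    fhat (lap φ) ξ = -((2 * Real.pi * ‖ξ‖) ^ 2 : ℝ) * fhat φ ξ := by
  rw [lap_eq_sum, fhat_sum _ fun i _ => (hφ.pd i).pd i, ← sum_sym_sq, Finset.sum_mul,
    Finset.sum_apply]
  refine Finset.sum_congr rfl fun i _ => ?_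
  rw [fhat_pd (hφ.pd i), fhat_pd hφ, mul_assoc]

lemma norm_fhat_polylap (hφ : IsTestFun U φ) (k : ℕ) (ξ : Euc N) :
    ‖fhat (polylap k φ) ξ‖ = (2 * Real.pi * ‖ξ‖) ^ (2 * k) * ‖fhat φ ξ‖ := by
  induction k with
  | zero => simp [polylap]
  | succ k ih =>
    rw [polylap, fhat_lap (hφ.polylap k), norm_mul, ih, norm_neg, Complex.norm_real,
      Real.norm_of_nonneg (by positivity)]
    ring

lemma pd_add (hφ : IsTestFun U φ) (hψ : IsTestFun U ψ) (i : Fin N) :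
    pd i (φ + ψ) = pd i φ + pd i ψ := by
  ext x
  simp only [pd, Pi.add_apply]
  rw [fderiv_add (hφ.smooth.differentiable (by simp)).differentiableAt
    (hψ.smooth.differentiable (by simp)).differentiableAt]
  rfl

lemma pd_smul (φ : Euc N → ℝ) (c : ℝ) (i : Fin N) : pd i (c • φ) = c • pd i φ := by
  ext x
  simp [pd, fderiv_const_smul_field]

lemma mderiv_add (hφ : IsTestFun U φ) (hψ : IsTestFun U ψ) (α : Fin N → ℕ) :
    mderiv α (φ + ψ) = mderiv α φ + mderiv α ψ := by
  have hit : ∀ {f g : Euc N → ℝ} (i : Fin N) (k : ℕ), IsTestFun U f → IsTestFun U g →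
      (pd i)^[k] (f + g) = (pd i)^[k] f + (pd i)^[k] g := fun i k hf hg => by
    induction k with
    | zero => rfl
    | succ k ih =>
      simp only [Function.iterate_succ_apply']
      rw [ih, pd_add (hf.pd_iterate i k) (hg.pd_iterate i k)]
  unfold mderiv
  induction List.finRange N with
  | nil => rfl
  | cons i l ih =>
    simp only [List.foldr_cons]
    rw [ih, hit i _ (hφ.foldr_pd α l) (hψ.foldr_pd α l)]

lemma mderiv_smul (φ : Euc N → ℝ) (c : ℝ) (α : Fin N → ℕ) :
    mderiv α (c • φ) = c • mderiv α φ := by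
  have hit : ∀ (f : Euc N → ℝ) (i : Fin N) (k : ℕ), (pd i)^[k] (c • f) = c • (pd i)^[k] f :=
    fun f i k => by
      induction k with
      | zero => rfl
      | succ k ih => simp only [Function.iterate_succ_apply', ih, pd_smul]
  unfold mderiv
  induction List.finRange N with
  | nil => rfl
  | cons i l ih =>
    simp only [List.foldr_cons]
    rw [ih, hit]

lemma polylap_add (hφ : IsTestFun U φ) (hψ : IsTestFun U ψ) (k : ℕ) :
    polylap k (φ + ψ) = polylap k φ + polylap k ψ := by
  induction k with
  | zero => rfl
  | succ k ih =>
    simp only [polylap, lap_eq_sum]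
    rw [ih, ← Finset.sum_add_distrib]
    refine Finset.sum_congr rfl fun i _ => ?_
    rw [pd_add (hφ.polylap k) (hψ.polylap k), pd_add ((hφ.polylap k).pd i) ((hψ.polylap k).pd i)]

lemma polylap_smul (φ : Euc N → ℝ) (c : ℝ) (k : ℕ) :
    polylap k (c • φ) = c • polylap k φ := by
  induction k with
  | zero => rfl
  | succ k ih =>
    simp only [polylap, lap_eq_sum]
    rw [ih, Finset.smul_sum]
    refine Finset.sum_congr rfl fun i _ => ?_
    rw [pd_smul, pd_smul]

end TestFunctions

end CL

namespace CL

section Plancherel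

variable {N : ℕ} {U : Set (Euc N)} {φ ψ : Euc N → ℝ}

lemma IsTestFun.memLp (hφ : IsTestFun U φ) (p : ℝ≥0∞) : MemLp φ p volume := by
  have h := (hφ.toSchwartz.memLp p volume).re
  exact h

lemma memLp_fhat (hφ : IsTestFun U φ) : MemLp (fhat φ) 2 volume := by
  rw [← hφ.fourier_toSchwartz]
  exact SchwartzMap.memLp _ _ _

lemma eLpNorm_fhat (hφ : IsTestFun U φ) : eLpNorm (fhat φ) 2 volume = eLpNorm φ 2 volume := by
  have h := SchwartzMap.norm_fourier_toL2_eq hφ.toSchwartz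
  rw [SchwartzMap.norm_toLp, SchwartzMap.norm_toLp, hφ.fourier_toSchwartz] at h
  rw [ENNReal.toReal_eq_toReal_iff' (memLp_fhat hφ).2.ne (SchwartzMap.memLp _ _ _).2.ne] at h
  rw [h]
  refine eLpNorm_congr_norm_ae (Filter.Eventually.of_forall fun x => ?_)
  rw [hφ.toSchwartz_apply, Complex.norm_real]

lemma enorm_fhat_le (hφ : IsTestFun U φ) (ξ : Euc N) : ‖fhat φ ξ‖ₑ ≤ eLpNorm φ 1 volume := by
  have h := SchwartzMap.norm_fourier_apply_le_toLp_one hφ.toSchwartz ξ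
  rw [SchwartzMap.norm_toLp, hφ.fourier_toSchwartz] at h
  rw [← ofReal_norm]
  refine (ENNReal.ofReal_le_ofReal h).trans (ENNReal.ofReal_toReal_le.trans (le_of_eq ?_))
  refine eLpNorm_congr_norm_ae (Filter.Eventually.of_forall fun x => ?_)
  rw [hφ.toSchwartz_apply, Complex.norm_real]

lemma integral_mul_re_fourierInv (hφ : IsTestFun U φ) (G : Lp ℂ 2 (volume : Measure (Euc N))) :
    ∫ x, φ x * ((𝓕⁻ G : Lp ℂ 2 (volume : Measure (Euc N))) x).re =
      (∫ ξ, conj (G ξ) * fhat φ ξ).re := by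
  set g : Lp ℂ 2 (volume : Measure (Euc N)) := 𝓕⁻ G
  have h := Lp.inner_fourier_eq g (hφ.toSchwartz.toLp 2)
  rw [SchwartzMap.toLp_fourier_eq, FourierInvPair.fourier_fourierInv_eq, L2.inner_def,
    L2.inner_def] at h
  have h1 : ∫ ξ, conj (G ξ) * fhat φ ξ =
      ∫ ξ, inner ℂ (G ξ) ((𝓕 hφ.toSchwartz : SchwartzMap (Euc N) ℂ).toLp 2 volume ξ) := by
    refine integral_congr_ae ?_
    filter_upwards [SchwartzMap.coeFn_toLp (𝓕 hφ.toSchwartz : SchwartzMap (Euc N) ℂ) 2 volume]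
      with ξ hξ
    rw [hξ, hφ.fourier_toSchwartz, RCLike.inner_apply, mul_comm]
  have hint := L2.integrable_inner (𝕜 := ℂ) g (hφ.toSchwartz.toLp 2)
  rw [h1, h]
  have h2 := integral_re hint
  refine Eq.trans ?_ h2
  refine integral_congr_ae ?_
  filter_upwards [SchwartzMap.coeFn_toLp hφ.toSchwartz 2 volume] with ξ hξ
  rw [hξ, hφ.toSchwartz_apply, RCLike.inner_apply]
  simp

lemma eLpNorm_two_sq {X F : Type*} [MeasurableSpace X] [NormedAddCommGroup F] (μ : Measure X)
    (f : X → F) : eLpNorm f 2 μ ^ 2 = ∫⁻ x, ‖f x‖ₑ ^ 2 ∂μ := by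
  have h := eLpNorm_nnreal_pow_eq_lintegral (f := f) (μ := μ) (p := 2) (by norm_num)
  simpa using h

end Plancherel

section Coercivity

variable {N : ℕ}

/-- The weight `1 + |ξ|`. -/
def wt (ξ : Euc N) : ℝ := 1 + ‖ξ‖

lemma one_le_wt (ξ : Euc N) : 1 ≤ wt ξ := by simp [wt]

lemma wt_pos (ξ : Euc N) : 0 < wt ξ := zero_lt_one.trans_le (one_le_wt ξ)

lemma continuous_wt : Continuous (wt : Euc N → ℝ) := by unfold wt; fun_prop

lemma continuous_sym (i : Fin N) : Continuous (sym i) := by unfold sym; fun_prop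

lemma continuous_msym (α : Fin N → ℕ) : Continuous (msym α) :=
  continuous_finsetProd _ fun i _ => (continuous_sym i).pow _

lemma norm_sym_le (i : Fin N) (ξ : Euc N) : ‖sym i ξ‖ ≤ 2 * Real.pi * wt ξ := by
  have h : ‖sym i ξ‖ = 2 * Real.pi * ‖ξ i‖ := by
    simp [sym, abs_of_pos Real.pi_pos]
  rw [h]
  have := PiLp.norm_apply_le ξ i
  have : ‖ξ i‖ ≤ wt ξ := by unfold wt; linarith
  gcongr

lemma one_le_two_pi_mul_wt (ξ : Euc N) : 1 ≤ 2 * Real.pi * wt ξ := by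
  nlinarith [one_le_wt ξ, Real.pi_gt_three]

lemma norm_msym_le {α : Fin N → ℕ} {k : ℕ} (hα : mdeg α ≤ k) (ξ : Euc N) :
    ‖msym α ξ‖ ≤ (2 * Real.pi * wt ξ) ^ k := by
  refine le_trans ?_ (pow_le_pow_right₀ (one_le_two_pi_mul_wt ξ) hα)
  rw [msym, norm_prod, mdeg, ← Finset.prod_pow_eq_pow_sum]
  refine Finset.prod_le_prod (fun i _ => norm_nonneg _) fun i _ => ?_
  rw [norm_pow]
  exact pow_le_pow_left₀ (norm_nonneg _) (norm_sym_le i ξ) _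

lemma exists_radius_volume_le (hN : 0 < N) :
    ∃ δ : ℝ, 0 < δ ∧ δ ≤ 1 ∧
      volume (Metric.ball (0 : Euc N) δ) * volume (ballUnit N) ≤ 1 / 2 := by
  set V := (volume (ballUnit N)).toReal
  have hV : volume (ballUnit N) = ENNReal.ofReal V :=
    (ENNReal.ofReal_toReal measure_ball_lt_top.ne).symm
  have hV0 : 0 ≤ V := ENNReal.toReal_nonneg
  refine ⟨1 / (2 * (V + 1) ^ 2), by positivity, ?_, ?_⟩
  · rw [div_le_one (by positivity)]
    nlinarith
  · set δ : ℝ := 1 / (2 * (V + 1) ^ 2) with hδ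
    have hδpos : 0 < δ := by positivity
    have hδ0 := hδpos.le
    have hδ1 : δ ≤ 1 := by
      rw [hδ, div_le_one (by positivity)]
      nlinarith
    have h1 : volume (Metric.ball (0 : Euc N) δ) = ENNReal.ofReal (δ ^ N) * ENNReal.ofReal V := by
      rw [Measure.addHaar_ball_of_pos _ _ hδpos, finrank_euclideanSpace_fin, ← hV]
      rfl
    rw [h1, hV, ← ENNReal.ofReal_mul (by positivity), ← ENNReal.ofReal_mul (by positivity)]
    have h2 : δ ^ N * V * V ≤ 1 / 2 := by
      have h3 : δ ^ N ≤ δ := by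
        simpa using pow_le_pow_of_le_one hδ0 hδ1 (Nat.one_le_iff_ne_zero.2 hN.ne')
      have h4 : δ * (V + 1) ^ 2 = 1 / 2 := by
        rw [hδ]; field_simp
      nlinarith [mul_nonneg hδ0 hV0, mul_le_mul_of_nonneg_right h3 (mul_nonneg hV0 hV0)]
    refine (ENNReal.ofReal_le_ofReal h2).trans (le_of_eq ?_)
    rw [ENNReal.ofReal_div_of_pos (by norm_num)]
    simp

/-- A function supported in the unit ball has at most half of its `L²` mass at low frequencies. -/
lemma lintegral_fhat_ball_le {δ : ℝ}
    (hδ : volume (Metric.ball (0 : Euc N) δ) * volume (ballUnit N) ≤ 1 / 2) {φ : Euc N → ℝ}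
    (hφ : IsTestFun (ballUnit N) φ) :
    ∫⁻ ξ in Metric.ball 0 δ, ‖fhat φ ξ‖ₑ ^ 2 ≤ 1 / 2 * ∫⁻ ξ, ‖fhat φ ξ‖ₑ ^ 2 := by
  have hs : φ.support ⊆ ballUnit N := (subset_tsupport φ).trans hφ.supp_subset
  have h1 : eLpNorm φ 1 volume ^ 2 ≤ (∫⁻ ξ, ‖fhat φ ξ‖ₑ ^ 2) * volume (ballUnit N) := by
    rw [← eLpNorm_two_sq, eLpNorm_fhat hφ,
      ← eLpNorm_restrict_eq_of_support_subset (p := 1) hs,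
      ← eLpNorm_restrict_eq_of_support_subset (p := 2) hs]
    have h := eLpNorm_le_eLpNorm_mul_rpow_measure_univ (μ := volume.restrict (ballUnit N))
      (p := 1) (q := 2) (by norm_num) (hφ.memLp 2).1.restrict
    refine (pow_le_pow_left₀ (zero_le) h 2).trans (le_of_eq ?_)
    rw [mul_pow, Measure.restrict_apply_univ, ← ENNReal.rpow_natCast _ 2, ← ENNReal.rpow_natCast _ 2,
      ← ENNReal.rpow_mul]
    norm_num
  calc ∫⁻ ξ in Metric.ball 0 δ, ‖fhat φ ξ‖ₑ ^ 2
      ≤ ∫⁻ ξ in Metric.ball (0 : Euc N) δ, eLpNorm φ 1 volume ^ 2 := by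
        gcongr with ξ
        exact enorm_fhat_le hφ ξ
    _ = eLpNorm φ 1 volume ^ 2 * volume (Metric.ball (0 : Euc N) δ) := by
        rw [setLIntegral_const]
    _ ≤ (∫⁻ ξ, ‖fhat φ ξ‖ₑ ^ 2) * volume (ballUnit N) * volume (Metric.ball (0 : Euc N) δ) := by
        gcongr
    _ = volume (Metric.ball (0 : Euc N) δ) * volume (ballUnit N) * ∫⁻ ξ, ‖fhat φ ξ‖ₑ ^ 2 := by
        ring
    _ ≤ _ := by gcongr

lemma wt_pow_mul_norm_fhat_le {δ : ℝ} (hδ : 0 < δ) {φ : Euc N → ℝ} {U : Set (Euc N)}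
    (hφ : IsTestFun U φ) (k : ℕ) {ξ : Euc N} (hξ : δ ≤ ‖ξ‖) :
    wt ξ ^ k * ‖fhat φ ξ‖ ≤
      (1 + 1 / δ) ^ (2 * (k + 1)) *
        ((wt ξ ^ (k + 2))⁻¹ * ‖fhat (polylap (k + 1) φ) ξ‖) := by
  rw [norm_fhat_polylap hφ]
  have h1 : wt ξ ≤ (1 + 1 / δ) * (2 * Real.pi * ‖ξ‖) := by
    have h2 : (1 : ℝ) ≤ 1 / δ * ‖ξ‖ := by
      rw [one_div, inv_mul_eq_div, le_div_iff₀ hδ]; linarith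
    have h3 : wt ξ ≤ (1 + 1 / δ) * ‖ξ‖ := by unfold wt; linarith
    have h4 : ‖ξ‖ ≤ 2 * Real.pi * ‖ξ‖ := by
      nlinarith [Real.pi_gt_three, norm_nonneg ξ]
    exact h3.trans (by gcongr)
  have h5 := pow_le_pow_left₀ (wt_pos ξ).le h1 (2 * (k + 1))
  rw [mul_pow] at h5
  have hw : 0 < wt ξ ^ (k + 2) := pow_pos (wt_pos ξ) _
  calc wt ξ ^ k * ‖fhat φ ξ‖ = (wt ξ ^ (k + 2))⁻¹ * (wt ξ ^ (2 * (k + 1)) * ‖fhat φ ξ‖) := by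
        field_simp
        ring
    _ ≤ (wt ξ ^ (k + 2))⁻¹ * (((1 + 1 / δ) ^ (2 * (k + 1)) *
          (2 * Real.pi * ‖ξ‖) ^ (2 * (k + 1))) * ‖fhat φ ξ‖) := by
        gcongr
    _ = _ := by ring

/-- The weighted Fourier transform of `Δ^{k+1} φ`. -/
def wlap (k : ℕ) (φ : Euc N → ℝ) : Euc N → ℂ :=
  fun ξ => ((wt ξ ^ (k + 2))⁻¹ : ℝ) • fhat (polylap (k + 1) φ) ξ

lemma norm_wlap (k : ℕ) (φ : Euc N → ℝ) (ξ : Euc N) :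
    ‖wlap k φ ξ‖ = (wt ξ ^ (k + 2))⁻¹ * ‖fhat (polylap (k + 1) φ) ξ‖ := by
  rw [wlap, norm_smul, Real.norm_of_nonneg (inv_nonneg.2 (pow_nonneg (wt_pos ξ).le _))]

lemma memLp_wlap {U : Set (Euc N)} {φ : Euc N → ℝ} (hφ : IsTestFun U φ) (k : ℕ) :
    MemLp (wlap k φ) 2 volume := by
  refine MemLp.of_le (memLp_fhat (hφ.polylap (k + 1))) ?_ (Filter.Eventually.of_forall fun ξ => ?_)
  · have h : Continuous fun ξ : Euc N => (wt ξ ^ (k + 2))⁻¹ :=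
      (continuous_wt.pow _).inv₀ fun ξ => (pow_pos (wt_pos ξ) _).ne'
    exact h.aestronglyMeasurable.smul (memLp_fhat (hφ.polylap (k + 1))).1
  · rw [norm_wlap]
    exact mul_le_of_le_one_left (norm_nonneg _) (inv_le_one_of_one_le₀ (one_le_pow₀ (one_le_wt ξ)))

lemma exists_coercivity (hN : 0 < N) (k : ℕ) :
    ∃ C : ℝ≥0, ∀ φ : Euc N → ℝ, IsTestFun (ballUnit N) φ →
      eLpNorm (fun ξ => wt ξ ^ k * ‖fhat φ ξ‖) 2 volume ≤ C * eLpNorm (wlap k φ) 2 volume := by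
  obtain ⟨δ, hδ, hδ1, hvol⟩ := exists_radius_volume_le hN
  set c : ℝ≥0∞ := ENNReal.ofReal ((1 + 1 / δ) ^ (2 * (k + 1))) with hc
  set M : ℝ≥0 := (4 ^ k + 1) * Real.toNNReal ((1 + 1 / δ) ^ (2 * (k + 1))) with hM
  refine ⟨M, fun φ hφ => ?_⟩
  have hlow := lintegral_fhat_ball_le hvol hφ
  set D := Metric.ball (0 : Euc N) δ with hD
  have hDm : MeasurableSet D := measurableSet_ball
  set u : Euc N → ℝ≥0∞ := fun ξ => ‖fhat φ ξ‖ₑ ^ 2 with hu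
  set v : Euc N → ℝ≥0∞ := fun ξ => ‖wt ξ ^ k * ‖fhat φ ξ‖‖ₑ ^ 2 with hv
  have hufin : ∫⁻ ξ, u ξ ≠ ⊤ := by
    rw [hu, ← eLpNorm_two_sq]
    exact ENNReal.pow_ne_top (memLp_fhat hφ).2.ne
  have hsplit := lintegral_add_compl u hDm (μ := volume)
  have h1 : ∫⁻ ξ in D, u ξ ≤ ∫⁻ ξ in Dᶜ, u ξ := by
    have hDfin : ∫⁻ ξ in D, u ξ ≠ ⊤ := ((setLIntegral_le_lintegral _ _).trans_lt
      hufin.lt_top).ne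
    have hDcfin : ∫⁻ ξ in Dᶜ, u ξ ≠ ⊤ := ((setLIntegral_le_lintegral _ _).trans_lt
      hufin.lt_top).ne
    rw [← hsplit] at hlow
    rw [← ENNReal.toReal_le_toReal hDfin hDcfin]
    have := ENNReal.toReal_mono (by finiteness) hlow
    rw [ENNReal.toReal_mul, ENNReal.toReal_add hDfin hDcfin] at this
    norm_num at this
    linarith
  have h2 : ∫⁻ ξ in D, v ξ ≤ 4 ^ k * ∫⁻ ξ in D, u ξ := by
    rw [← lintegral_const_mul' _ _ (by finiteness)]
    refine setLIntegral_mono' hDm fun ξ hξ => ?_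
    have hw : wt ξ ≤ 2 := by
      have : ‖ξ‖ < δ := by simpa [hD] using hξ
      unfold wt; linarith
    have hw' : ‖wt ξ ^ k‖ₑ ≤ 2 ^ k := by
      rw [enorm_pow]
      gcongr
      rw [← ofReal_norm, Real.norm_of_nonneg (wt_pos ξ).le]
      exact (ENNReal.ofReal_le_ofReal hw).trans (by simp)
    simp only [hv, hu, enorm_mul, enorm_norm, mul_pow]
    refine mul_le_mul' ?_ le_rfl
    calc ‖wt ξ ^ k‖ₑ ^ 2 ≤ (2 ^ k) ^ 2 := by gcongr
      _ = 4 ^ k := by rw [← pow_mul, mul_comm, pow_mul]; norm_num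
  have h3 : ∀ ξ, u ξ ≤ v ξ := fun ξ => by
    simp only [hv, hu, enorm_mul, enorm_norm]
    gcongr
    refine le_mul_of_one_le_left zero_le ?_
    rw [← ofReal_norm, Real.norm_of_nonneg (pow_nonneg (wt_pos ξ).le _), ENNReal.one_le_ofReal]
    exact one_le_pow₀ (one_le_wt ξ)
  have h4 : ∫⁻ ξ in Dᶜ, v ξ ≤ c ^ 2 * ∫⁻ ξ, ‖wlap k φ ξ‖ₑ ^ 2 := by
    rw [← lintegral_const_mul' _ _ (by finiteness)]
    refine (setLIntegral_mono' hDm.compl fun ξ hξ => ?_).trans (setLIntegral_le_lintegral _ _)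
    have hξ' : δ ≤ ‖ξ‖ := by simpa [hD] using hξ
    simp only [hv]
    rw [← mul_pow]
    gcongr
    rw [← ofReal_norm, ← ofReal_norm, hc, ← ENNReal.ofReal_mul (by positivity), norm_wlap,
      Real.norm_of_nonneg (mul_nonneg (pow_nonneg (wt_pos ξ).le _) (norm_nonneg _))]
    exact ENNReal.ofReal_le_ofReal (wt_pow_mul_norm_fhat_le hδ hφ k hξ')
  have h5 : ∫⁻ ξ, v ξ ≤ (4 ^ k + 1) * (c ^ 2 * ∫⁻ ξ, ‖wlap k φ ξ‖ₑ ^ 2) := by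
    rw [← lintegral_add_compl v hDm]
    calc _ ≤ 4 ^ k * (∫⁻ ξ in Dᶜ, v ξ) + ∫⁻ ξ in Dᶜ, v ξ := by
          refine add_le_add (h2.trans (mul_le_mul' le_rfl ?_)) le_rfl
          exact h1.trans (lintegral_mono h3)
      _ = (4 ^ k + 1) * ∫⁻ ξ in Dᶜ, v ξ := by ring
      _ ≤ _ := by gcongr
  have h6 : eLpNorm (fun ξ => wt ξ ^ k * ‖fhat φ ξ‖) 2 volume ^ 2 ≤
      (M * eLpNorm (wlap k φ) 2 volume) ^ 2 := by
    rw [mul_pow, eLpNorm_two_sq, eLpNorm_two_sq]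
    refine h5.trans ?_
    rw [← mul_assoc]
    gcongr
    have : (M : ℝ≥0∞) = (4 ^ k + 1) * c := by
      rw [hM, hc, ENNReal.ofReal]
      push_cast
      rfl
    rw [this, mul_pow]
    gcongr
    exact le_self_pow₀ (by simp) (by norm_num)
  exact (ENNReal.pow_le_pow_left_iff two_ne_zero).1 h6

/-- Coercivity: derivatives up to order `k` of functions supported in the unit ball are controlled
by the weighted Fourier transform of `Δ^{k+1} φ`. -/
lemma exists_eLpNorm_mderiv_le (hN : 0 < N) (k : ℕ) :
    ∃ C : ℝ≥0, ∀ φ : Euc N → ℝ, IsTestFun (ballUnit N) φ → ∀ α : Fin N → ℕ, mdeg α ≤ k →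
      eLpNorm (mderiv α φ) 2 volume ≤ C * eLpNorm (wlap k φ) 2 volume := by
  obtain ⟨C, hC⟩ := exists_coercivity hN k
  refine ⟨Real.toNNReal ((2 * Real.pi) ^ k) * C, fun φ hφ α hα => ?_⟩
  rw [← eLpNorm_fhat (hφ.mderiv α)]
  push_cast
  rw [mul_assoc]
  refine le_trans ?_ (mul_le_mul_right (hC φ hφ) _)
  refine eLpNorm_le_mul_eLpNorm_of_ae_le_mul (Filter.Eventually.of_forall fun ξ => ?_) 2
  rw [fhat_mderiv hφ, norm_mul,
    Real.norm_of_nonneg (mul_nonneg (pow_nonneg (wt_pos ξ).le _) (norm_nonneg _)), ← mul_assoc,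
    ← mul_pow]
  gcongr
  exact norm_msym_le hα ξ

end Coercivity

end CL

namespace CL

section ScalarSolution

variable {N : ℕ}

lemma mdeg_toMI_le {k : ℕ} {α : Fin N → Fin (k + 1)} (hα : α ∈ mIdx N k) :
    mdeg (toMI α) ≤ k :=
  (Finset.mem_filter.1 hα).2

/-- The space of test functions on the unit ball. -/
def testSub (N : ℕ) : Submodule ℝ (Euc N → ℝ) where
  carrier := {φ | IsTestFun (ballUnit N) φ}
  add_mem' h h' := IsTestFun.add h h'
  zero_mem' := isTestFun_zero
  smul_mem' c _ h := IsTestFun.smul h c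

lemma wlap_add {U : Set (Euc N)} {φ ψ : Euc N → ℝ} (hφ : IsTestFun U φ) (hψ : IsTestFun U ψ)
    (k : ℕ) : wlap k (φ + ψ) = wlap k φ + wlap k ψ := by
  ext ξ
  simp only [wlap, Pi.add_apply]
  rw [polylap_add hφ hψ, fhat_add (hφ.polylap _) (hψ.polylap _), Pi.add_apply, smul_add]

lemma wlap_smul {U : Set (Euc N)} {φ : Euc N → ℝ} (hφ : IsTestFun U φ) (c : ℝ) (k : ℕ) :
    wlap k (c • φ) = c • wlap k φ := by
  ext ξ
  simp only [wlap, Pi.smul_apply]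
  rw [polylap_smul, fhat_smul (hφ.polylap _), Pi.smul_apply, smul_comm]
  rfl

/-- `φ ↦ wlap k φ` as a linear map into `L²`. -/
def wlapMap (N k : ℕ) : testSub N →ₗ[ℝ] Lp ℂ 2 (volume : Measure (Euc N)) where
  toFun φ := (memLp_wlap φ.2 k).toLp
  map_add' φ ψ := by
    rw [← MemLp.toLp_add]
    congr 1
    exact wlap_add φ.2 ψ.2 k
  map_smul' c φ := by
    rw [RingHom.id_apply, ← MemLp.toLp_const_smul]
    congr 1
    exact wlap_smul φ.2 c k

lemma enorm_wlapMap (k : ℕ) (φ : testSub N) :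
    ‖wlapMap N k φ‖ₑ = eLpNorm (wlap k (φ : Euc N → ℝ)) 2 volume := by
  rw [Lp.enorm_def]
  exact eLpNorm_congr_ae (memLp_wlap φ.2 k).coeFn_toLp

lemma inner_wlapMap (F : Lp ℂ 2 (volume : Measure (Euc N))) (k : ℕ) (φ : testSub N) :
    inner ℝ F (wlapMap N k φ) = (∫ ξ, conj (F ξ) * wlap k (φ : Euc N → ℝ) ξ).re := by
  have hw := memLp_wlap φ.2 k
  have hint : Integrable (fun ξ => conj (F ξ) * wlap k (φ : Euc N → ℝ) ξ) volume :=
    MemLp.integrable_mul (p := 2) (q := 2) (Lp.memLp F).star hw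
  rw [L2.inner_def]
  refine Eq.trans ?_ (integral_re hint)
  refine integral_congr_ae ?_
  filter_upwards [hw.coeFn_toLp] with ξ hξ
  change inner ℝ (F ξ) (hw.toLp _ ξ) = _
  rw [hξ, Complex.inner, mul_comm]
  rfl

lemma memLp_mul_Lp (F : Lp ℂ 2 (volume : Measure (Euc N))) {p : Euc N → ℂ}
    (hp : Continuous p) {c : ℝ} (hc : ∀ ξ, ‖p ξ‖ ≤ c) :
    MemLp (fun ξ => p ξ * F ξ) 2 volume := by
  refine MemLp.of_le_mul (Lp.memLp F) (hp.aestronglyMeasurable.mul (Lp.memLp F).1)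
    (c := c) (Filter.Eventually.of_forall fun ξ => ?_)
  rw [norm_mul]
  exact mul_le_mul_of_nonneg_right (hc ξ) (norm_nonneg _)

/-- Real part of the inverse Fourier transform of `p F`, for a bounded multiplier `p`. -/
lemma exists_re_fourierInv (F : Lp ℂ 2 (volume : Measure (Euc N))) {p : Euc N → ℂ}
    (hp : Continuous p) {c : ℝ} (hc : ∀ ξ, ‖p ξ‖ ≤ c) :
    ∃ h : Euc N → ℝ, MemLp h 2 volume ∧ eLpNorm h 2 volume ≤ ENNReal.ofReal c * ‖F‖ₑ ∧
      ∀ (U : Set (Euc N)) (φ : Euc N → ℝ), IsTestFun U φ →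
        ∫ x, φ x * h x = (∫ ξ, conj (p ξ * F ξ) * fhat φ ξ).re := by
  have hG := memLp_mul_Lp F hp hc
  set G := hG.toLp with hGdef
  set g : Lp ℂ 2 (volume : Measure (Euc N)) := 𝓕⁻ G with hg
  have hgG : ‖g‖ₑ = ‖G‖ₑ := by
    have h : ‖(𝓕 g : Lp ℂ 2 (volume : Measure (Euc N)))‖ = ‖g‖ := Lp.norm_fourier_eq g
    rw [hg, FourierInvPair.fourier_fourierInv_eq] at h
    rw [← ofReal_norm, ← ofReal_norm, h]
  refine ⟨fun x => (g x).re, (Lp.memLp g).re, ?_, fun U φ hφ => ?_⟩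
  · calc eLpNorm (fun x => (g x).re) 2 volume ≤ eLpNorm g 2 volume :=
          eLpNorm_mono fun x => Complex.abs_re_le_norm _
      _ = eLpNorm G 2 volume := by rw [← Lp.enorm_def, hgG, Lp.enorm_def]
      _ = eLpNorm (fun ξ => p ξ * F ξ) 2 volume := eLpNorm_congr_ae hG.coeFn_toLp
      _ ≤ _ := by
        rw [Lp.enorm_def]
        refine eLpNorm_le_mul_eLpNorm_of_ae_le_mul (Filter.Eventually.of_forall fun ξ => ?_) 2
        rw [norm_mul]
        exact mul_le_mul_of_nonneg_right (hc ξ) (norm_nonneg _)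
  · rw [integral_mul_re_fourierInv hφ]
    congr 1
    refine integral_congr_ae ?_
    filter_upwards [hG.coeFn_toLp] with ξ hξ
    rw [hξ]

/-- The Fourier multiplier giving `∂^β Ω_i` in terms of the representing vector. -/
def solMul (k : ℕ) (i : Fin N) (β : Fin N → ℕ) (ξ : Euc N) : ℂ :=
  (-1) ^ mdeg β * conj (msym β ξ * sym i ξ) * ((wt ξ ^ (k + 2))⁻¹ : ℝ)

lemma continuous_solMul (k : ℕ) (i : Fin N) (β : Fin N → ℕ) : Continuous (solMul k i β) := by
  have h : Continuous fun ξ : Euc N => (wt ξ ^ (k + 2))⁻¹ :=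
    (continuous_wt.pow _).inv₀ fun ξ => (pow_pos (wt_pos ξ) _).ne'
  exact (continuous_const.mul
    (Complex.continuous_conj.comp ((continuous_msym β).mul (continuous_sym i)))).mul
    (Complex.continuous_ofReal.comp h)

lemma norm_solMul_le {k : ℕ} (i : Fin N) {β : Fin N → ℕ} (hβ : mdeg β ≤ k + 1) (ξ : Euc N) :
    ‖solMul k i β ξ‖ ≤ (2 * Real.pi) ^ (k + 2) := by
  have hw : 0 < wt ξ ^ (k + 2) := pow_pos (wt_pos ξ) _
  have h1 : ‖msym β ξ‖ * ‖sym i ξ‖ ≤ (2 * Real.pi * wt ξ) ^ (k + 1) * (2 * Real.pi * wt ξ) :=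
    mul_le_mul (norm_msym_le hβ ξ) (norm_sym_le i ξ) (norm_nonneg _)
      (pow_nonneg (zero_le_one.trans (one_le_two_pi_mul_wt ξ)) _)
  rw [← pow_succ, mul_pow] at h1
  rw [solMul, norm_mul, norm_mul, norm_pow, norm_neg, norm_one, one_pow, one_mul,
    RCLike.norm_conj, norm_mul, Complex.norm_real, Real.norm_of_nonneg (inv_nonneg.2 hw.le),
    ← div_eq_mul_inv, div_le_iff₀ hw]
  exact h1

lemma conj_solMul (k : ℕ) (i : Fin N) (β : Fin N → ℕ) (ξ : Euc N) :
    conj (solMul k i β ξ) =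
      (-1) ^ mdeg β * (msym β ξ * sym i ξ) * ((wt ξ ^ (k + 2))⁻¹ : ℝ) := by
  simp [solMul]

lemma sum_conj_solMul {k : ℕ} {U : Set (Euc N)} {φ : Euc N → ℝ} (hφ : IsTestFun U φ)
    (ξ : Euc N) :
    ∑ i, conj (solMul k i 0 ξ) * fhat (pd i (polylap k φ)) ξ = wlap k φ ξ := by
  have h0 : msym (0 : Fin N → ℕ) ξ = 1 := by simp [msym]
  have h0' : mdeg (0 : Fin N → ℕ) = 0 := by simp [mdeg]
  simp only [conj_solMul, h0, h0', fhat_pd (hφ.polylap k)]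
  rw [wlap, polylap, fhat_lap (hφ.polylap k), ← sum_sym_sq, Finset.sum_mul, Finset.smul_sum]
  refine Finset.sum_congr rfl fun i _ => ?_
  rw [Complex.real_smul]
  ring

/-- Solvability of the scalar equation `Δ^k δ h = T` with a gain of regularity. -/
theorem exists_scalar_solution (hN : 0 < N) (k : ℕ) :
    ∃ C : ℝ≥0, ∀ (T : testSub N →ₗ[ℝ] ℝ) (K : ℝ≥0),
      (∀ φ, ‖T φ‖ₑ ≤ K * ∑ α ∈ mIdx N k, eLpNorm (mderiv (toMI α) (φ : Euc N → ℝ)) 2 volume) →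
      ∃ h : Fin N → (Fin N → ℕ) → Euc N → ℝ,
        (∀ i β, mdeg β ≤ k + 1 →
          MemLp (h i β) 2 volume ∧ eLpNorm (h i β) 2 volume ≤ C * K) ∧
        (∀ i β, mdeg β ≤ k + 1 → ∀ φ, IsTestFun (ballUnit N) φ →
          ∫ x, mderiv β φ x * h i 0 x = (-1) ^ mdeg β * ∫ x, φ x * h i β x) ∧
        ∀ φ : testSub N, ∑ i, ∫ x, pd i (polylap k (φ : Euc N → ℝ)) x * h i 0 x = T φ := by
  obtain ⟨C, hC⟩ := exists_eLpNorm_mderiv_le hN k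
  refine ⟨Real.toNNReal ((2 * Real.pi) ^ (k + 2)) * ((mIdx N k).card * C), fun T K hT => ?_⟩
  set K' : ℝ≥0 := (mIdx N k).card * C * K with hK'
  have hTA : ∀ φ, |T φ| ≤ K' * ‖wlapMap N k φ‖ := fun φ => by
    have h1 : ‖T φ‖ₑ ≤ K' * ‖wlapMap N k φ‖ₑ := by
      refine (hT φ).trans ?_
      have h2 : ∑ α ∈ mIdx N k, eLpNorm (mderiv (toMI α) (φ : Euc N → ℝ)) 2 volume ≤
          (mIdx N k).card • (C * eLpNorm (wlap k (φ : Euc N → ℝ)) 2 volume) := by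
        refine Finset.sum_le_card_nsmul _ _ _ fun α hα =>
          hC φ φ.2 _ (mdeg_toMI_le hα)
      refine (mul_le_mul' le_rfl h2).trans (le_of_eq ?_)
      rw [enorm_wlapMap, hK', nsmul_eq_mul]
      push_cast
      ring
    have h3 := ENNReal.toReal_mono (by finiteness) h1
    rw [ENNReal.toReal_mul] at h3
    simpa using h3
  obtain ⟨F, hF, hTF⟩ := exists_representing_vector (wlapMap N k) T K'.2 hTA
  have hF' : ‖F‖ₑ ≤ K' := by
    rw [← ofReal_norm]
    exact (ENNReal.ofReal_le_ofReal hF).trans (by simp)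
  have hex : ∀ (i : Fin N) (β : Fin N → ℕ), ∃ h : Euc N → ℝ, mdeg β ≤ k + 1 →
      MemLp h 2 volume ∧ eLpNorm h 2 volume ≤ ENNReal.ofReal ((2 * Real.pi) ^ (k + 2)) * ‖F‖ₑ ∧
      ∀ (U : Set (Euc N)) (φ : Euc N → ℝ), IsTestFun U φ →
        ∫ x, φ x * h x = (∫ ξ, conj (solMul k i β ξ * F ξ) * fhat φ ξ).re := fun i β => by
    by_cases hβ : mdeg β ≤ k + 1
    · obtain ⟨h, hh⟩ := exists_re_fourierInv F (continuous_solMul k i β) (norm_solMul_le i hβ)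
      exact ⟨h, fun _ => hh⟩
    · exact ⟨0, fun h => absurd h hβ⟩
  choose h hh using hex
  have h0 : mdeg (0 : Fin N → ℕ) ≤ k + 1 := by simp [mdeg]
  refine ⟨h, fun i β hβ => ⟨(hh i β hβ).1, (hh i β hβ).2.1.trans ?_⟩, fun i β hβ φ hφ => ?_,
    fun φ => ?_⟩
  · refine (mul_le_mul' le_rfl hF').trans (le_of_eq ?_)
    rw [hK', ENNReal.ofReal]
    push_cast
    ring
  · rw [(hh i 0 h0).2.2 _ _ (hφ.mderiv β), (hh i β hβ).2.2 _ _ hφ]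
    have h1 : ∀ ξ, conj (solMul k i β ξ * F ξ) * fhat φ ξ =
        (((-1) ^ mdeg β : ℝ) : ℂ) *
          (conj (solMul k i 0 ξ * F ξ) * fhat (mderiv β φ) ξ) := fun ξ => by
      have h2 : msym (0 : Fin N → ℕ) ξ = 1 := by simp [msym]
      have h3 : mdeg (0 : Fin N → ℕ) = 0 := by simp [mdeg]
      rw [map_mul, map_mul, conj_solMul, conj_solMul, fhat_mderiv hφ, h2, h3]
      push_cast
      ring
    simp_rw [h1]
    rw [integral_const_mul, Complex.re_ofReal_mul, ← mul_assoc, ← mul_pow]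
    norm_num
  · have hφ : IsTestFun (ballUnit N) φ := φ.2
    rw [hTF, inner_wlapMap]
    have h1 : ∀ i, Integrable
        (fun ξ => conj (solMul k i 0 ξ * F ξ) * fhat (pd i (polylap k (φ : Euc N → ℝ))) ξ) volume := fun i =>
      MemLp.integrable_mul (p := 2) (q := 2)
        (memLp_mul_Lp F (continuous_solMul k i 0) (norm_solMul_le i h0)).star
        (memLp_fhat ((hφ.polylap k).pd i))
    have h2 : ∀ ξ, conj (F ξ) * wlap k (φ : Euc N → ℝ) ξ =
        ∑ i, conj (solMul k i 0 ξ * F ξ) * fhat (pd i (polylap k φ)) ξ := fun ξ => by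
      rw [← sum_conj_solMul hφ, Finset.mul_sum]
      refine Finset.sum_congr rfl fun i _ => ?_
      rw [map_mul]
      ring
    simp_rw [h2]
    rw [integral_finsetSum _ fun i _ => h1 i, Complex.re_sum]
    refine Finset.sum_congr rfl fun i _ => ?_
    rw [(hh i 0 h0).2.2 _ _ ((hφ.polylap k).pd i)]

end ScalarSolution

end CL

namespace CL

section Functional

variable {N : ℕ} {E : Type*} [NormedAddCommGroup E]

instance isFiniteMeasure_restrict_ballUnit :
    IsFiniteMeasure ((volume : Measure (Euc N)).restrict (ballUnit N)) :=
  ⟨by rw [Measure.restrict_apply_univ]; exact measure_ball_lt_top⟩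

lemma MemLorentz.memLp {g : Euc N → E} (hg : MemLorentz 2 2 (ballUnit N) g) :
    MemLp g 2 (volume.restrict (ballUnit N)) :=
  ⟨hg.1, by rw [← lorentzNorm_eq_eLpNorm hg.1]; exact hg.2⟩

lemma memLorentz_of_memLp {g : Euc N → E} (hg : MemLp g 2 (volume.restrict (ballUnit N))) :
    MemLorentz 2 2 (ballUnit N) g :=
  ⟨hg.1, by rw [lorentzNormOn, lorentzNorm_eq_eLpNorm hg.1]; exact hg.2⟩

variable [NormedSpace ℝ E]

/-- Hölder's inequality with the Lorentz norm; no measurability of `g` is needed. -/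
lemma enorm_integral_smul_le {X : Type*} [MeasurableSpace X] {μ : Measure X} [IsFiniteMeasure μ]
    {φ : X → ℝ} (hφ : AEStronglyMeasurable φ μ) (g : X → E) :
    ‖∫ x, φ x • g x ∂μ‖ₑ ≤ eLpNorm φ 2 μ * lorentzNorm 2 2 μ g := by
  by_cases hi : Integrable (fun x => φ x • g x) μ
  · set g' : X → E := fun x => (φ x)⁻¹ • (φ x • g x) with hg'
    have hg'm : AEStronglyMeasurable g' μ := hφ.inv₀.smul hi.1
    have h1 : (fun x => φ x • g x) = φ • g' := by
      ext x
      by_cases h : φ x = 0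
      · simp [h]
      · simp [hg', smul_smul, h]
    have h2 : ∀ x, ‖g' x‖ ≤ ‖g x‖ := fun x => by
      by_cases h : φ x = 0
      · simp [hg', h]
      · simp [hg', smul_smul, h]
    calc ‖∫ x, φ x • g x ∂μ‖ₑ ≤ eLpNorm (φ • g') 1 μ := by
          rw [← h1, eLpNorm_one_eq_lintegral_enorm]
          exact enorm_integral_le_lintegral_enorm _
      _ ≤ eLpNorm φ 2 μ * eLpNorm g' 2 μ := eLpNorm_smul_le_mul_eLpNorm hg'm hφ
      _ ≤ _ := by
        rw [← lorentzNorm_eq_eLpNorm hg'm]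
        exact mul_le_mul' le_rfl (lorentzNorm_mono h2)
  · rw [integral_undef hi, enorm_zero]
    exact zero_le

lemma slNorm_le {k : ℕ} {p q : ℝ≥0∞} {U : Set (Euc N)} {f : Euc N → E}
    {g : (Fin N → ℕ) → Euc N → E} (hg : ∀ α, mdeg α ≤ k → HasWeakDeriv U α f (g α)) :
    slNorm k p q U f ≤ ∑ α ∈ mIdx N k, lorentzNormOn p q U (g (toMI α)) :=
  sInf_le ⟨g, hg, rfl⟩

lemma slNegNorm_lt_top {k : ℕ} {η : Euc N → E} (hη : MemSLneg k 2 2 (ballUnit N) η) :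
    slNegNorm k 2 2 (ballUnit N) η < ⊤ := by
  obtain ⟨g, hg, hrep⟩ := hη
  refine lt_of_le_of_lt (sInf_le ⟨g, hrep, rfl⟩) (ENNReal.sum_lt_top.2 fun α hα => ?_)
  exact (hg _ (mdeg_toMI_le hα)).2

lemma enorm_integral_le_slNegNorm {k : ℕ} {η : Euc N → E}
    (hη : MemSLneg k 2 2 (ballUnit N) η) {φ : Euc N → ℝ} (hφ : IsTestFun (ballUnit N) φ) :
    ‖∫ x in ballUnit N, φ x • η x‖ₑ ≤ slNegNorm k 2 2 (ballUnit N) η *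
      ∑ α ∈ mIdx N k, eLpNorm (mderiv (toMI α) φ) 2 volume := by
  set P := ∑ α ∈ mIdx N k, eLpNorm (mderiv (toMI α) φ) 2 volume with hP
  have key : ∀ g : (Fin N → ℕ) → Euc N → E, (∀ φ : Euc N → ℝ, IsTestFun (ballUnit N) φ →
      ∫ x in ballUnit N, φ x • η x = ∑ α ∈ mIdx N k, ((-1 : ℝ) ^ mdeg (toMI α)) •
        ∫ x in ballUnit N, mderiv (toMI α) φ x • g (toMI α) x) →
      ‖∫ x in ballUnit N, φ x • η x‖ₑ ≤
        (∑ α ∈ mIdx N k, lorentzNormOn 2 2 (ballUnit N) (g (toMI α))) * P := fun g hg => by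
    rw [hg φ hφ]
    refine (enorm_sum_le _ _).trans ?_
    rw [Finset.sum_mul]
    refine Finset.sum_le_sum fun α hα => ?_
    rw [enorm_smul, enorm_pow, enorm_neg, enorm_one, one_pow, one_mul]
    refine (enorm_integral_smul_le ((hφ.mderiv _).memLp 2).1.restrict _).trans ?_
    rw [mul_comm]
    refine mul_le_mul' le_rfl ((eLpNorm_mono_measure _ Measure.restrict_le_self).trans ?_)
    exact Finset.single_le_sum (f := fun α => eLpNorm (mderiv (toMI α) φ) 2 volume)
      (fun _ _ => zero_le) hα
  have hPtop : P ≠ ⊤ := (ENNReal.sum_lt_top.2 fun α _ => ((hφ.mderiv _).memLp 2).2).ne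
  rcases eq_or_ne P 0 with hP0 | hP0
  · obtain ⟨g, -, hrep⟩ := hη
    have := key g hrep
    rw [hP0, mul_zero] at this ⊢
    exact this
  · rw [← ENNReal.div_le_iff hP0 hPtop]
    refine le_sInf ?_
    rintro M ⟨g, hrep, rfl⟩
    rw [ENNReal.div_le_iff hP0 hPtop]
    exact key g hrep

/-- An element of the negative Sobolev space as a linear functional on test functions. -/
lemma exists_linearMap_of_memSLneg {k : ℕ} {η : Euc N → E}
    (hη : MemSLneg k 2 2 (ballUnit N) η) :
    ∃ L : testSub N →ₗ[ℝ] E, ∀ φ, L φ = ∫ x in ballUnit N, (φ : Euc N → ℝ) x • η x := by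
  obtain ⟨g, hg, hrep⟩ := hη
  have hint : ∀ α ∈ mIdx N k, ∀ φ : Euc N → ℝ, IsTestFun (ballUnit N) φ →
      Integrable (fun x => mderiv (toMI α) φ x • g (toMI α) x)
        (volume.restrict (ballUnit N)) := fun α hα φ hφ =>
    memLp_one_iff_integrable.1 (MemLp.smul (p := 2) (q := 2)
      (hg _ (mdeg_toMI_le hα)).memLp (((hφ.mderiv _).memLp 2).restrict _))
  refine ⟨{ toFun := fun φ => ∫ x in ballUnit N, (φ : Euc N → ℝ) x • η x
            map_add' := fun φ ψ => ?_, map_smul' := fun c φ => ?_ }, fun φ => rfl⟩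
  · have hφ : IsTestFun (ballUnit N) φ := φ.2
    have hψ : IsTestFun (ballUnit N) ψ := ψ.2
    rw [hrep _ hφ, hrep _ hψ, hrep _ (φ + ψ).2, ← Finset.sum_add_distrib]
    refine Finset.sum_congr rfl fun α hα => ?_
    rw [← smul_add, ← integral_add (hint α hα _ hφ) (hint α hα _ hψ), Submodule.coe_add,
      mderiv_add hφ hψ]
    simp only [Pi.add_apply, add_smul]
  · rw [hrep _ φ.2, hrep _ (c • φ).2, RingHom.id_apply, Finset.smul_sum]
    refine Finset.sum_congr rfl fun α _ => ?_
    rw [smul_comm c, ← integral_smul c, Submodule.coe_smul, mderiv_smul]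
    simp only [Pi.smul_apply, smul_assoc]

end Functional

section Assembly

variable {N : ℕ} {E : Type*} [NormedAddCommGroup E] [NormedSpace ℝ E]
  {ι : Type*} [Fintype ι]

lemma memLp_sum_smul {g : ι → Euc N → ℝ} (hg : ∀ j, MemLp (g j) 2 volume) (e : ι → E) :
    MemLp (fun x => ∑ j, g j x • e j) 2 (volume.restrict (ballUnit N)) := by
  refine memLp_finsetSum _ fun j _ => ?_
  exact ((ContinuousLinearMap.toSpanSingleton ℝ (e j)).comp_memLp' (hg j)).restrict _

lemma lorentzNormOn_sum_smul_le {g : ι → Euc N → ℝ} (hg : ∀ j, MemLp (g j) 2 volume) (e : ι → E)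
    {M : ℝ≥0∞} (hM : ∀ j, eLpNorm (g j) 2 volume ≤ M) :
    lorentzNormOn 2 2 (ballUnit N) (fun x => ∑ j, g j x • e j) ≤ (∑ j, ‖e j‖ₑ) * M := by
  rw [lorentzNormOn, lorentzNorm_eq_eLpNorm (memLp_sum_smul hg e).1, Finset.sum_mul]
  refine (eLpNorm_mono_measure _ Measure.restrict_le_self).trans ?_
  have h1 : (fun x => ∑ j, g j x • e j) = ∑ j, fun x => g j x • e j := by
    ext x; simp
  rw [h1]
  refine (eLpNorm_sum_le (fun j _ =>
    ((ContinuousLinearMap.toSpanSingleton ℝ (e j)).comp_memLp' (hg j)).1) (by norm_num)).trans ?_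
  refine Finset.sum_le_sum fun j _ => ?_
  refine le_trans ?_ (mul_le_mul' le_rfl (hM j))
  rw [← ofReal_norm]
  refine eLpNorm_le_mul_eLpNorm_of_ae_le_mul (Filter.Eventually.of_forall fun x => ?_) 2
  rw [Function.comp_apply, ContinuousLinearMap.toSpanSingleton_apply, norm_smul, mul_comm]

variable [CompleteSpace E]

lemma setIntegral_smul_sum {φ : Euc N → ℝ} (hφ : IsTestFun (ballUnit N) φ) {f : ι → Euc N → ℝ}
    (hf : ∀ j, MemLp (f j) 2 volume) (e : ι → E) :
    ∫ x in ballUnit N, φ x • ∑ j, f j x • e j = ∑ j, (∫ x, φ x * f j x) • e j := by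
  have hs : φ.support ⊆ ballUnit N := (subset_tsupport φ).trans hφ.supp_subset
  rw [setIntegral_eq_integral_of_forall_compl_eq_zero fun x hx => by
    rw [Function.notMem_support.1 fun h => hx (hs h), zero_smul]]
  simp_rw [Finset.smul_sum, smul_smul]
  rw [integral_finsetSum]
  · exact Finset.sum_congr rfl fun j _ => integral_smul_const _ _
  · intro j _
    have h : Integrable (fun x => φ x * f j x) volume :=
      MemLp.integrable_mul (p := 2) (q := 2) (hφ.memLp 2) (hf j)
    exact h.smul_const _

lemma hasWeakDeriv_sum_smul {β : Fin N → ℕ} {f g : ι → Euc N → ℝ}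
    (hf : ∀ j, MemLp (f j) 2 volume) (hg : ∀ j, MemLp (g j) 2 volume)
    (h : ∀ j φ, IsTestFun (ballUnit N) φ →
      ∫ x, mderiv β φ x * f j x = (-1) ^ mdeg β * ∫ x, φ x * g j x) (e : ι → E) :
    HasWeakDeriv (ballUnit N) β (fun x => ∑ j, f j x • e j) (fun x => ∑ j, g j x • e j) := by
  intro φ hφ
  rw [setIntegral_smul_sum (hφ.mderiv β) hf, setIntegral_smul_sum hφ hg, Finset.smul_sum]
  refine Finset.sum_congr rfl fun j _ => ?_
  rw [h j φ hφ, smul_smul]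

end Assembly

end CL

namespace CL

section Matrices

variable {n : ℕ}

/-- Transposition, as a continuous linear equivalence for the Frobenius norm. -/
def transposeCLE (n : ℕ) : Mat n ≃L[ℝ] Mat n :=
  (⟨Matrix.transposeLinearEquiv (Fin n) (Fin n) ℝ ℝ, fun A =>
    Matrix.frobenius_norm_transpose A⟩ : Mat n ≃ₗᵢ[ℝ] Mat n).toContinuousLinearEquiv

lemma isAntisym_integral {X : Type*} [MeasurableSpace X] {μ : Measure X} {φ : X → ℝ}
    {η : X → Mat n} (hη : ∀ x, IsAntisym (η x)) : IsAntisym (∫ x, φ x • η x ∂μ) := by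
  have h := (transposeCLE n).integral_comp_comm (μ := μ) fun x => φ x • η x
  have h1 : ∀ x, transposeCLE n (φ x • η x) = -(φ x • η x) := fun x => by
    rw [map_smul, ← smul_neg, ← hη x]
    rfl
  have h2 : ∫ x, -(φ x • η x) ∂μ = transposeCLE n (∫ x, φ x • η x ∂μ) :=
    (integral_congr_ae (Filter.Eventually.of_forall fun x => (h1 x).symm)).trans h
  rw [integral_neg] at h2
  exact h2.symm

lemma enorm_entry_le (A : Mat n) (a b : Fin n) : ‖A a b‖ₑ ≤ ‖A‖ₑ := by
  rw [← ofReal_norm, ← ofReal_norm]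
  refine ENNReal.ofReal_le_ofReal ?_
  rw [Matrix.frobenius_norm_def, ← Real.sqrt_eq_rpow]
  refine Real.le_sqrt_of_sq_le ?_
  have h1 : ‖A a b‖ ^ (2 : ℝ) ≤ ∑ j, ‖A a j‖ ^ (2 : ℝ) :=
    Finset.single_le_sum (f := fun j => ‖A a j‖ ^ (2 : ℝ)) (fun _ _ => by positivity)
      (Finset.mem_univ b)
  have h2 : ∑ j, ‖A a j‖ ^ (2 : ℝ) ≤ ∑ i, ∑ j, ‖A i j‖ ^ (2 : ℝ) :=
    Finset.single_le_sum (f := fun i => ∑ j, ‖A i j‖ ^ (2 : ℝ)) (fun _ _ => by positivity)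
      (Finset.mem_univ a)
  rw [← Real.rpow_two]
  exact h1.trans h2

/-- The antisymmetrization of an elementary matrix. -/
def skewUnit (a b : Fin n) : Mat n :=
  (1 / 2 : ℝ) • (Matrix.single a b 1 - Matrix.single b a 1)

lemma isAntisym_sum_skewUnit {ι : Type*} [Fintype ι] (c : ι → ℝ) (p : ι → Fin n × Fin n) :
    IsAntisym (∑ j, c j • skewUnit (p j).1 (p j).2) := by
  rw [IsAntisym, Matrix.transpose_sum, ← Finset.sum_neg_distrib]
  refine Finset.sum_congr rfl fun j _ => ?_
  rw [skewUnit, Matrix.transpose_smul, Matrix.transpose_smul, Matrix.transpose_sub,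
    Matrix.transpose_single, Matrix.transpose_single, ← smul_neg, ← smul_neg, neg_sub]

lemma IsAntisym.sum_skewUnit {A : Mat n} (hA : IsAntisym A) :
    ∑ p : Fin n × Fin n, A p.1 p.2 • skewUnit p.1 p.2 = A := by
  have h1 : ∑ p : Fin n × Fin n, A p.1 p.2 • Matrix.single p.1 p.2 (1 : ℝ) = A := by
    rw [Fintype.sum_prod_type]
    conv_rhs => rw [Matrix.matrix_eq_sum_single A]
    simp
  have h2 : ∑ p : Fin n × Fin n, A p.1 p.2 • Matrix.single p.2 p.1 (1 : ℝ) = A.transpose := by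
    conv_rhs => rw [← h1]
    rw [Matrix.transpose_sum]
    simp
  calc ∑ p : Fin n × Fin n, A p.1 p.2 • skewUnit p.1 p.2
      = ∑ p : Fin n × Fin n, (1 / 2 : ℝ) • (A p.1 p.2 • Matrix.single p.1 p.2 (1 : ℝ) -
          A p.1 p.2 • Matrix.single p.2 p.1 (1 : ℝ)) :=
        Finset.sum_congr rfl fun p _ => by
          rw [skewUnit, smul_comm, smul_sub]
    _ = (1 / 2 : ℝ) • (A - A.transpose) := by
        rw [← Finset.smul_sum, Finset.sum_sub_distrib, h1, h2]
    _ = A := by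
        rw [show A.transpose = -A from hA, sub_neg_eq_add, smul_add, ← add_smul]
        norm_num

end Matrices

/-- Solvability of `Δ^k δ Ω = -η` on the unit ball with a gain of regularity. -/
theorem exists_gauge_potential {N : ℕ} (hN : 0 < N) (n k : ℕ) :
    ∃ c : ℝ≥0∞, 0 < c ∧ c < ⊤ ∧
      ∀ η : Euc N → Mat n,
        (∀ x, IsAntisym (η x)) →
        MemSLneg k 2 2 (ballUnit N) η →
        ∃ Ωf : Euc N → Fin N → Mat n,
          (∀ x i, IsAntisym (Ωf x i)) ∧
          MemSL (k + 1) 2 2 (ballUnit N) Ωf ∧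
          (∀ φ : Euc N → ℝ, IsTestFun (ballUnit N) φ →
            -∑ i, ∫ x in ballUnit N, pd i (polylap k φ) x • Ωf x i
              = -∫ x in ballUnit N, φ x • η x) ∧
          slNorm (k + 1) 2 2 (ballUnit N) Ωf ≤ c * slNegNorm k 2 2 (ballUnit N) η := by
  obtain ⟨C, hC⟩ := exists_scalar_solution hN k
  set e : Fin N × Fin n × Fin n → Fin N → Mat n :=
    fun j => Pi.single j.1 (skewUnit j.2.1 j.2.2) with he
  refine ⟨(mIdx N (k + 1)).card * ((∑ j, ‖e j‖ₑ) * C) + 1, by simp, ?_, fun η hη hneg => ?_⟩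
  · have h : ∑ j, ‖e j‖ₑ < ⊤ := ENNReal.sum_lt_top.2 fun j _ => enorm_lt_top
    finiteness
  obtain ⟨L, hL⟩ := exists_linearMap_of_memSLneg hneg
  set K : ℝ≥0 := (slNegNorm k 2 2 (ballUnit N) η).toNNReal with hKdef
  have hK : (K : ℝ≥0∞) = slNegNorm k 2 2 (ballUnit N) η :=
    ENNReal.coe_toNNReal (slNegNorm_lt_top hneg).ne
  have hLK : ∀ φ, ‖L φ‖ₑ ≤
      K * ∑ α ∈ mIdx N k, eLpNorm (mderiv (toMI α) (φ : Euc N → ℝ)) 2 volume := fun φ => by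
    rw [hL, hK]
    exact enorm_integral_le_slNegNorm hneg φ.2
  have hsol := fun p : Fin n × Fin n => hC (Matrix.entryLinearMap ℝ ℝ p.1 p.2 ∘ₗ L) K
    fun φ => (enorm_entry_le (L φ) p.1 p.2).trans (hLK φ)
  choose h hmem hweak heq using hsol
  have h0 : mdeg (0 : Fin N → ℕ) ≤ k + 1 := by simp [mdeg]
  set D : (Fin N → ℕ) → Euc N → Fin N → Mat n :=
    fun β x => ∑ j : Fin N × Fin n × Fin n, h j.2 j.1 β x • e j with hD
  have hDapply : ∀ x i, D 0 x i = ∑ p : Fin n × Fin n, h p i 0 x • skewUnit p.1 p.2 :=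
    fun x i => by
      simp only [hD, he, Finset.sum_apply, Pi.smul_apply]
      rw [Fintype.sum_prod_type, Finset.sum_eq_single i]
      · simp
      · intro j _ hj
        simp [Pi.single_eq_of_ne hj.symm]
      · simp
  have hDweak : ∀ β, mdeg β ≤ k + 1 → HasWeakDeriv (ballUnit N) β (D 0) (D β) := fun β hβ =>
    hasWeakDeriv_sum_smul (fun j => (hmem j.2 j.1 0 h0).1) (fun j => (hmem j.2 j.1 β hβ).1)
      (fun j => hweak j.2 j.1 β hβ) e
  refine ⟨D 0, fun x i => ?_, ⟨D, hDweak, fun β hβ => ?_⟩, fun φ hφ => ?_, ?_⟩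
  · rw [hDapply]
    exact isAntisym_sum_skewUnit _ _
  · exact memLorentz_of_memLp (memLp_sum_smul (fun j => (hmem j.2 j.1 β hβ).1) e)
  · congr 1
    simp_rw [hDapply]
    simp_rw [setIntegral_smul_sum ((hφ.polylap k).pd _) (fun p => (hmem p _ 0 h0).1)]
    rw [Finset.sum_comm]
    have h1 : IsAntisym (L ⟨φ, hφ⟩) := by
      rw [hL]
      exact isAntisym_integral hη
    refine Eq.trans ?_ (hL ⟨φ, hφ⟩)
    rw [← h1.sum_skewUnit]
    refine Finset.sum_congr rfl fun p _ => ?_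
    rw [← Finset.sum_smul]
    congr 1
    exact heq p ⟨φ, hφ⟩
  · have h1 : ∀ β, mdeg β ≤ k + 1 →
        lorentzNormOn 2 2 (ballUnit N) (D β) ≤ (∑ j, ‖e j‖ₑ) * (C * K) := fun β hβ =>
      lorentzNormOn_sum_smul_le (E := Fin N → Mat n) (ι := Fin N × Fin n × Fin n)
        (g := fun j => h j.2 j.1 β) (M := C * K) (fun j => (hmem j.2 j.1 β hβ).1) e
        (fun j => (hmem j.2 j.1 β hβ).2)
    refine (slNorm_le hDweak).trans ?_
    refine (Finset.sum_le_card_nsmul _ _ _ fun α hα =>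
      h1 (toMI α) (mdeg_toMI_le hα)).trans ?_
    rw [nsmul_eq_mul, ← hK, add_mul, mul_assoc, mul_assoc]
    exact le_self_add

end CL

open CL in
/-- Solving `Δ^{m-2} δ Ω = -η` with a gain of regularity (equation (4.1)/(4.2)). -/
theorem gauge_potential_existence
    (m n : ℕ) (hm : 2 ≤ m) :
    ∃ c : ℝ≥0∞, 0 < c ∧ c < ⊤ ∧
      ∀ η : Euc (2 * m) → Mat n,
        (∀ x, IsAntisym (η x)) →
        MemSLneg (m - 2) 2 2 (ballUnit (2 * m)) η →
        ∃ Ωf : Euc (2 * m) → Fin (2 * m) → Mat n,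
          (∀ x i, IsAntisym (Ωf x i)) ∧
          MemSL (m - 1) 2 2 (ballUnit (2 * m)) Ωf ∧
          (∀ φ : Euc (2 * m) → ℝ, IsTestFun (ballUnit (2 * m)) φ →
            -∑ i, ∫ x in ballUnit (2 * m), pd i (polylap (m - 2) φ) x • Ωf x i
              = -∫ x in ballUnit (2 * m), φ x • η x) ∧
          slNorm (m - 1) 2 2 (ballUnit (2 * m)) Ωf ≤
            c * slNegNorm (m - 2) 2 2 (ballUnit (2 * m)) η := by
  obtain ⟨k, rfl⟩ := Nat.exists_eq_add_of_le' hm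
  exact exists_gauge_potential (by omega) n k
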